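/- Let μ = m∘Π⁻¹. Suppose there are constants h(μ) ≤ 0 and χ₂(μ) ≤ χ₁(μ) < 0 such that for m-almost every i ∈ Σ: lim_{n→∞} (1/n) log m([i|n]) = h(μ), lim_{n→∞} (1/n) log α₁(D_{Π(σⁿi)} S_{i|n}) = χ₁(μ), and lim_{n→∞} (1/n) log α₂(D_{Π(σⁿi)} S_{i|n}) = χ₂(μ), and suppose π(μ) is exact dimensional with exact dimension t. Then for μ-almost every x, the upper local dimension satisfies limsup_{r→0} log μ(B(x,r))/log r ≤ h(μ)/χ₂(μ) + ((χ₂(μ) − χ₁(μ))/χ₂(μ))·t. -/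

import Mathlib

open MeasureTheory Filter Set

noncomputable section

namespace FFL

/-- The unit square `[0,1]² ⊆ ℝ²`. -/
def sq : Set (ℝ × ℝ) := Set.Icc (0:ℝ) 1 ×ˢ Set.Icc (0:ℝ) 1

/-- The Euclidean metric on `ℝ²`. -/
def dE (a b : ℝ × ℝ) : ℝ := Real.sqrt ((a.1 - b.1) ^ 2 + (a.2 - b.2) ^ 2)

/-- Squared Frobenius norm of a 2×2 real matrix. -/
def frobSq (A : Matrix (Fin 2) (Fin 2) ℝ) : ℝ := ∑ i, ∑ j, (A i j) ^ 2

/-- The larger singular value `α₁` of a 2×2 real matrix, i.e. the larger positive square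
root of the eigenvalues of `AᵀA`, via the standard closed formula. -/
def sv1 (A : Matrix (Fin 2) (Fin 2) ℝ) : ℝ :=
  Real.sqrt ((frobSq A + Real.sqrt ((frobSq A) ^ 2 - 4 * (A.det) ^ 2)) / 2)

/-- The smaller singular value `α₂` of a 2×2 real matrix. -/
def sv2 (A : Matrix (Fin 2) (Fin 2) ℝ) : ℝ :=
  Real.sqrt ((frobSq A - Real.sqrt ((frobSq A) ^ 2 - 4 * (A.det) ^ 2)) / 2)

/-- The nonlinear, non-conformal iterated function systems of Falconer, Fraser and Lee:
maps `S i (a₁,a₂) = (f i a₁, g i (a₁,a₂))` on the unit square, where `f i`, `g i` are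
`C^{1+α}` contractions (with partial derivatives `fx`, `gx`, `gy`) satisfying the
domination condition. -/
structure System (I : Type) [Fintype I] where
  f : I → ℝ → ℝ
  g : I → ℝ × ℝ → ℝ
  fx : I → ℝ → ℝ
  gx : I → ℝ × ℝ → ℝ
  gy : I → ℝ × ℝ → ℝ
  /-- the index set has at least two elements -/
  card2 : 2 ≤ Fintype.card I
  /-- each `S i` maps the unit square into itself -/
  mapsTo : ∀ i, Set.MapsTo (fun a => (f i a.1, g i a)) sq sq
  /-- `fx i` is the derivative of `f i` on `[0,1]` -/
  hasDeriv_f : ∀ i, ∀ x ∈ Set.Icc (0:ℝ) 1,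
    HasDerivWithinAt (f i) (fx i x) (Set.Icc (0:ℝ) 1) x
  /-- `(gx i, gy i)` is the (total) derivative of `g i` on the unit square -/
  hasDeriv_g : ∀ i, ∀ a ∈ sq, HasFDerivWithinAt (g i)
      (gx i a • ContinuousLinearMap.fst ℝ ℝ ℝ + gy i a • ContinuousLinearMap.snd ℝ ℝ ℝ) sq a
  /-- the derivatives are `α`-Hölder for some `α > 0`, i.e. `f i`, `g i` are `C^{1+α}` -/
  holder : ∃ α > (0:ℝ), ∃ H > (0:ℝ), ∀ i,
      (∀ x ∈ Set.Icc (0:ℝ) 1, ∀ y ∈ Set.Icc (0:ℝ) 1, |fx i x - fx i y| ≤ H * |x - y| ^ α) ∧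
      (∀ a ∈ sq, ∀ b ∈ sq, |gx i a - gx i b| ≤ H * dE a b ^ α) ∧
      (∀ a ∈ sq, ∀ b ∈ sq, |gy i a - gy i b| ≤ H * dE a b ^ α)
  /-- the maps `f i`, `g i` (hence `S i`) are uniform contractions -/
  contracting : ∃ c, 0 ≤ c ∧ c < 1 ∧ ∀ i,
      (∀ x ∈ Set.Icc (0:ℝ) 1, ∀ y ∈ Set.Icc (0:ℝ) 1, |f i x - f i y| ≤ c * |x - y|) ∧
      (∀ a ∈ sq, ∀ b ∈ sq, |g i a - g i b| ≤ c * dE a b) ∧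
      (∀ a ∈ sq, ∀ b ∈ sq, dE (f i a.1, g i a) (f i b.1, g i b) ≤ c * dE a b)
  /-- the domination condition:
  `inf |f_{i,x}| > sup |g_{i,y}| ≥ inf |g_{i,y}| ≥ d > 0` -/
  domination : ∃ d > (0:ℝ), ∀ i,
      d ≤ sInf ((fun a => |gy i a|) '' sq) ∧
      sSup ((fun a => |gy i a|) '' sq) < sInf ((fun x => |fx i x|) '' Set.Icc (0:ℝ) 1)

variable {I : Type} [Fintype I]

/-- The map `S i`. -/
def S (T : System I) (i : I) (a : ℝ × ℝ) : ℝ × ℝ := (T.f i a.1, T.g i a)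

/-- The composition `S_w = S_{i₁} ∘ ⋯ ∘ S_{i_n}` along a finite word `w = (i₁,…,i_n)`. -/
def Sw (T : System I) : List I → ℝ × ℝ → ℝ × ℝ
  | [], a => a
  | i :: w, a => S T i (Sw T w a)

/-- The top-left entry `f_{w,x}(a)` of the (lower triangular) Jacobian `D_a S_w`,
via the chain rule. -/
def fxw (T : System I) : List I → ℝ × ℝ → ℝ
  | [], _ => 1
  | i :: w, a => T.fx i (Sw T w a).1 * fxw T w a

/-- The bottom-right entry `g_{w,y}(a)` of the Jacobian `D_a S_w`. -/
def gyw (T : System I) : List I → ℝ × ℝ → ℝ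
  | [], _ => 1
  | i :: w, a => T.gy i (Sw T w a) * gyw T w a

/-- The off-diagonal entry `g_{w,x}(a)` of the Jacobian `D_a S_w`. -/
def gxw (T : System I) : List I → ℝ × ℝ → ℝ
  | [], _ => 0
  | i :: w, a => T.gx i (Sw T w a) * fxw T w a + T.gy i (Sw T w a) * gxw T w a

/-- The Jacobian matrix `D_a S_w`. -/
def Dmat (T : System I) (w : List I) (a : ℝ × ℝ) : Matrix (Fin 2) (Fin 2) ℝ :=
  !![fxw T w a, 0; gxw T w a, gyw T w a]

/-- The larger singular value `α₁(D_a S_w)`. -/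
def alpha1 (T : System I) (w : List I) (a : ℝ × ℝ) : ℝ := sv1 (Dmat T w a)

/-- The smaller singular value `α₂(D_a S_w)`. -/
def alpha2 (T : System I) (w : List I) (a : ℝ × ℝ) : ℝ := sv2 (Dmat T w a)

/-- The restriction `i|n` of an infinite sequence to its first `n` symbols. -/
def word (ii : ℕ → I) (n : ℕ) : List I := List.ofFn (fun k : Fin n => ii k.1)

/-- The iterated left shift `σⁿ`. -/
def shiftn (ii : ℕ → I) (n : ℕ) : ℕ → I := fun k => ii (k + n)

/-- The left shift `σ` on `Σ = I^ℕ`. -/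
def shift (ii : ℕ → I) : ℕ → I := fun k => ii (k + 1)

/-- The cylinder set `[w] ⊆ Σ` of a finite word `w`. -/
def cyl (w : List I) : Set (ℕ → I) := {jj | ∀ k : Fin w.length, jj k.1 = w.get k}

/-- `F` is the attractor of the IFS: the (unique) nonempty compact subset of the unit
square with `F = ⋃ i, S i '' F`. -/
def IsAttractor (T : System I) (F : Set (ℝ × ℝ)) : Prop :=
  F.Nonempty ∧ IsCompact F ∧ F ⊆ sq ∧ F = ⋃ i, S T i '' F

/-- The strong separation condition: the sets `S i '' F` are pairwise disjoint. -/
def SSC (T : System I) (F : Set (ℝ × ℝ)) : Prop :=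
  ∀ i j : I, i ≠ j → Disjoint (S T i '' F) (S T j '' F)

/-- `Pi` is the canonical coding map `Π : Σ → [0,1]²`:
`Π(i)` is the unique point of `⋂ₙ S_{i|n}([0,1]²)`. -/
def IsCoding (T : System I) (Pi : (ℕ → I) → ℝ × ℝ) : Prop :=
  ∀ ii : ℕ → I, ∀ n : ℕ, Pi ii ∈ Sw T (word ii n) '' sq

/-- `m` is quasi-Bernoulli with constant `L`:
`L⁻¹ m[w] m[v] ≤ m[wv] ≤ L m[w] m[v]` for all finite words `w, v`. -/
def QuasiBernoulli [MeasurableSpace I] (m : Measure (ℕ → I)) (L : ℝ) : Prop :=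
  0 < L ∧ ∀ w v : List I,
    L⁻¹ * (m (cyl w)).toReal * (m (cyl v)).toReal ≤ (m (cyl (w ++ v))).toReal ∧
    (m (cyl (w ++ v))).toReal ≤ L * (m (cyl w)).toReal * (m (cyl v)).toReal

/-- The interval `Q₁(x,r) = [x - r/2, x + r/2]`. -/
def Q1 (x r : ℝ) : Set ℝ := Set.Icc (x - r / 2) (x + r / 2)

/-- The square `Q₂(a,r) = (a₁ - r/2, a₁ + r/2) × (a₂ - r/2, a₂ + r/2)`. -/
def Q2 (a : ℝ × ℝ) (r : ℝ) : Set (ℝ × ℝ) :=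
  Set.Ioo (a.1 - r / 2) (a.1 + r / 2) ×ˢ Set.Ioo (a.2 - r / 2) (a.2 + r / 2)

/-- The approximate square `B_n(a,r)`: points `b ∈ S_w([0,1]²)` with `|b₁ - a₁| ≤ r/2`. -/
def Bn (T : System I) (w : List I) (a : ℝ × ℝ) (r : ℝ) : Set (ℝ × ℝ) :=
  {b ∈ Sw T w '' sq | |b.1 - a.1| ≤ r / 2}

/-- The closed Euclidean ball in `ℝ²`. -/
def ballE (x : ℝ × ℝ) (r : ℝ) : Set (ℝ × ℝ) := {y | dE x y ≤ r}

/-- A measure on `ℝ` is exact dimensional with dimension `s` if for a.e. `x`,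
`log ν(B(x,r)) / log r → s` as `r → 0⁺`. -/
def ExactDim1 (ν : Measure ℝ) (s : ℝ) : Prop :=
  ∀ᵐ x ∂ν, Tendsto (fun r => Real.log (ν (Metric.closedBall x r)).toReal / Real.log r)
    (nhdsWithin 0 (Set.Ioi 0)) (nhds s)

/-- A measure on `ℝ²` is exact dimensional with dimension `s` (w.r.t. Euclidean balls). -/
def ExactDim2 (ν : Measure (ℝ × ℝ)) (s : ℝ) : Prop :=
  ∀ᵐ x ∂ν, Tendsto (fun r => Real.log (ν (ballE x r)).toReal / Real.log r)
    (nhdsWithin 0 (Set.Ioi 0)) (nhds s)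

/-- `η = sup_{i ∈ I, a, b ∈ [0,1]²} |g_{i,y}(a)| / |f_{i,x}(b)|`. -/
def eta (T : System I) : ℝ :=
  sSup {x : ℝ | ∃ i : I, ∃ a ∈ sq, ∃ b ∈ sq, x = |T.gy i a| / |T.fx i b.1|}

end FFL

open FFL

namespace FFL

section Geometry

variable {I : Type} [Fintype I] (T : System I)

lemma dE_nonneg (a b : ℝ × ℝ) : 0 ≤ dE a b := Real.sqrt_nonneg _

lemma abs_fst_sub_le_dE (a b : ℝ × ℝ) : |a.1 - b.1| ≤ dE a b :=
  Real.abs_le_sqrt (by nlinarith [sq_nonneg (a.2 - b.2)])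

lemma abs_snd_sub_le_dE (a b : ℝ × ℝ) : |a.2 - b.2| ≤ dE a b :=
  Real.abs_le_sqrt (by nlinarith [sq_nonneg (a.1 - b.1)])

lemma dE_le_add (a b : ℝ × ℝ) : dE a b ≤ |a.1 - b.1| + |a.2 - b.2| := by
  refine Real.sqrt_le_iff.2 ⟨by positivity, ?_⟩
  nlinarith [sq_abs (a.1 - b.1), sq_abs (a.2 - b.2), abs_nonneg (a.1 - b.1),
    abs_nonneg (a.2 - b.2), mul_nonneg (abs_nonneg (a.1 - b.1)) (abs_nonneg (a.2 - b.2))]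

lemma dist_le_dE (a b : ℝ × ℝ) : dist a b ≤ dE a b := by
  rw [Prod.dist_eq, Real.dist_eq, Real.dist_eq]
  exact max_le (abs_fst_sub_le_dE a b) (abs_snd_sub_le_dE a b)

lemma continuous_dE : Continuous fun p : (ℝ × ℝ) × (ℝ × ℝ) => dE p.1 p.2 := by
  unfold dE
  fun_prop

lemma abs_sub_le_one {x y : ℝ} (hx : x ∈ Set.Icc (0:ℝ) 1) (hy : y ∈ Set.Icc (0:ℝ) 1) :
    |x - y| ≤ 1 := by
  rw [abs_le]
  constructor <;> linarith [hx.1, hx.2, hy.1, hy.2]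

lemma dE_le_two {a b : ℝ × ℝ} (ha : a ∈ sq) (hb : b ∈ sq) : dE a b ≤ 2 := by
  have h1 := abs_sub_le_one ha.1 hb.1
  have h2 := abs_sub_le_one ha.2 hb.2
  linarith [dE_le_add a b]

lemma convex_sq : Convex ℝ sq := (convex_Icc 0 1).prod (convex_Icc 0 1)

lemma zero_mem_sq : (0 : ℝ × ℝ) ∈ sq := ⟨⟨le_rfl, zero_le_one⟩, ⟨le_rfl, zero_le_one⟩⟩

lemma Sw_append (w v : List I) (a : ℝ × ℝ) : Sw T (w ++ v) a = Sw T w (Sw T v a) := by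
  induction w with
  | nil => rfl
  | cons i w ih => simp [Sw, ih]

lemma Sw_mapsTo (w : List I) : Set.MapsTo (Sw T w) sq sq := by
  induction w with
  | nil => exact fun a ha => ha
  | cons i w ih => exact fun a ha => T.mapsTo i (ih ha)

/-- Mean value estimate for `f i`, with the derivative taken at an endpoint. -/
lemma abs_f_sub_le {α H : ℝ} (hα : 0 < α) (hH : 0 < H) (i : I)
    (hol : ∀ x ∈ Set.Icc (0:ℝ) 1, ∀ y ∈ Set.Icc (0:ℝ) 1, |T.fx i x - T.fx i y| ≤ H * |x - y| ^ α)
    {x y : ℝ} (hx : x ∈ Set.Icc (0:ℝ) 1) (hy : y ∈ Set.Icc (0:ℝ) 1) :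
    |T.f i x - T.f i y| ≤ (|T.fx i y| + H * |x - y| ^ α) * |x - y| := by
  have hsub : Set.uIcc y x ⊆ Set.Icc (0:ℝ) 1 := Set.uIcc_subset_Icc hy hx
  refine Convex.norm_image_sub_le_of_norm_hasDerivWithin_le (s := Set.uIcc y x)
    (f := T.f i) (f' := T.fx i) (fun z hz => (T.hasDeriv_f i z (hsub hz)).mono hsub)
    (fun z hz => ?_) (convex_uIcc y x) Set.left_mem_uIcc Set.right_mem_uIcc
  have h1 := hol z (hsub hz) y hy
  have h2 : |z - y| ^ α ≤ |x - y| ^ α :=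
    Real.rpow_le_rpow (abs_nonneg _) (Set.abs_sub_left_of_mem_uIcc hz) hα.le
  have h3 : |T.fx i z| ≤ |T.fx i y| + |T.fx i z - T.fx i y| := by
    linarith [abs_sub_abs_le_abs_sub (T.fx i z) (T.fx i y)]
  rw [Real.norm_eq_abs]
  nlinarith

/-- Mean value estimate for `g i`, with the vertical derivative taken at an endpoint. -/
lemma abs_g_sub_le {α H G : ℝ} (hα : 0 < α) (hH : 0 < H) (i : I)
    (hol : ∀ a ∈ sq, ∀ b ∈ sq, |T.gy i a - T.gy i b| ≤ H * dE a b ^ α)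
    (hG : ∀ a ∈ sq, |T.gx i a| ≤ G)
    {a b : ℝ × ℝ} (ha : a ∈ sq) (hb : b ∈ sq) :
    |T.g i a - T.g i b| ≤ G * |a.1 - b.1| + (|T.gy i b| + H * dE a b ^ α) * |a.2 - b.2| := by
  set p : ℝ → ℝ × ℝ := fun s => b + s • (a - b) with hp
  have hmaps : Set.MapsTo p (Set.Icc 0 1) sq := fun s hs =>
    convex_sq.add_smul_sub_mem hb ha hs
  have hpd : ∀ s ∈ Set.Icc (0:ℝ) 1, HasDerivWithinAt p (a - b) (Set.Icc 0 1) s := by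
    intro s _
    have := ((hasDerivAt_id s).smul_const (a - b)).const_add b
    simpa [hp] using this.hasDerivWithinAt
  have key := norm_image_sub_le_of_norm_deriv_le_segment_01' (f := fun s => T.g i (p s))
    (f' := fun s => T.gx i (p s) * (a.1 - b.1) + T.gy i (p s) * (a.2 - b.2))
    (C := G * |a.1 - b.1| + (|T.gy i b| + H * dE a b ^ α) * |a.2 - b.2|)
    (fun s hs => by
      have := HasFDerivWithinAt.comp_hasDerivWithinAt s (T.hasDeriv_g i (p s) (hmaps hs))
        (hpd s hs) hmaps
      simpa [Function.comp_def] using this)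
    (fun s hs => by
      have hs' : s ∈ Set.Icc (0:ℝ) 1 := ⟨hs.1, hs.2.le⟩
      have hdist : dE (p s) b ≤ dE a b := by
        refine Real.sqrt_le_sqrt ?_
        have hs2 : s ^ 2 ≤ 1 := by nlinarith [hs.1, hs.2]
        have e1 : ((p s).1 - b.1) = s * (a.1 - b.1) := by simp [hp]
        have e2 : ((p s).2 - b.2) = s * (a.2 - b.2) := by simp [hp]
        rw [e1, e2]
        nlinarith [sq_nonneg (a.1 - b.1), sq_nonneg (a.2 - b.2)]
      have h1 := hol (p s) (hmaps hs') b hb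
      have h2 : dE (p s) b ^ α ≤ dE a b ^ α :=
        Real.rpow_le_rpow (dE_nonneg _ _) hdist hα.le
      have h3 : |T.gy i (p s)| ≤ |T.gy i b| + H * dE a b ^ α := by
        have := abs_sub_abs_le_abs_sub (T.gy i (p s)) (T.gy i b)
        nlinarith
      rw [Real.norm_eq_abs]
      refine (abs_add_le _ _).trans ?_
      rw [abs_mul, abs_mul]
      gcongr
      exact hG _ (hmaps hs'))
  simpa [hp] using key

/-- Uniform constants of a system: contraction ratio `c`, Hölder data `α`, `H`, lower bound `d`
for `|gy|`, domination gap `κ`, and upper bound `G` for `|gx|`. -/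
lemma exists_constants : ∃ c α H d κ G : ℝ, 0 ≤ c ∧ c < 1 ∧ 0 < α ∧ 0 < H ∧ 0 < d ∧ 0 < κ ∧ 0 ≤ G ∧
    (∀ i, ∀ a ∈ sq, ∀ b ∈ sq, dE (S T i a) (S T i b) ≤ c * dE a b) ∧
    (∀ i, ∀ x ∈ Set.Icc (0:ℝ) 1, ∀ y ∈ Set.Icc (0:ℝ) 1,
      |T.fx i x - T.fx i y| ≤ H * |x - y| ^ α) ∧
    (∀ i, ∀ a ∈ sq, ∀ b ∈ sq, |T.gy i a - T.gy i b| ≤ H * dE a b ^ α) ∧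
    (∀ i, ∀ a ∈ sq, d ≤ |T.gy i a|) ∧
    (∀ i, ∀ a ∈ sq, ∀ x ∈ Set.Icc (0:ℝ) 1, |T.gy i a| + κ ≤ |T.fx i x|) ∧
    (∀ i, ∀ a ∈ sq, |T.gx i a| ≤ G) := by
  obtain ⟨c, hc0, hc1, hc⟩ := T.contracting
  obtain ⟨α, hα, H, hH, hol⟩ := T.holder
  obtain ⟨d, hd, hdom⟩ := T.domination
  have hpow : ∀ a ∈ sq, H * dE a 0 ^ α ≤ H * 2 ^ α := fun a ha => by
    have := Real.rpow_le_rpow (dE_nonneg a 0) (dE_le_two ha zero_mem_sq) hα.le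
    gcongr
  have hbdd : ∀ i, BddAbove ((fun a => |T.gy i a|) '' sq) := by
    refine fun i => ⟨|T.gy i 0| + H * 2 ^ α, ?_⟩
    rintro _ ⟨a, ha, rfl⟩
    have h1 := (hol i).2.2 a ha 0 zero_mem_sq
    have := abs_sub_abs_le_abs_sub (T.gy i a) (T.gy i 0)
    have := hpow a ha
    show |T.gy i a| ≤ _
    linarith
  have hbelow : ∀ {β : Type} (u : β → ℝ) (s : Set β), BddBelow ((fun a => |u a|) '' s) := by
    intro β u s
    refine ⟨0, ?_⟩
    rintro _ ⟨a, -, rfl⟩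
    exact abs_nonneg _
  have : Nonempty I := Fintype.card_pos_iff.1 (by have := T.card2; omega)
  obtain ⟨i₀, hi₀⟩ := Finite.exists_min fun i =>
    sInf ((fun x => |T.fx i x|) '' Set.Icc (0:ℝ) 1) - sSup ((fun a => |T.gy i a|) '' sq)
  refine ⟨c, α, H, d, _, ∑ i, |T.gx i 0| + H * 2 ^ α, hc0, hc1, hα, hH, hd,
    sub_pos.2 (hdom i₀).2, by positivity, fun i => (hc i).2.2, fun i => (hol i).1,
    fun i => (hol i).2.2, fun i a ha => ?_, fun i a ha x hx => ?_, fun i a ha => ?_⟩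
  · exact (hdom i).1.trans (csInf_le (hbelow _ _) ⟨a, ha, rfl⟩)
  · have h1 := le_csSup (hbdd i) ⟨a, ha, rfl⟩
    have h2 := csInf_le (hbelow (T.fx i) (Set.Icc (0:ℝ) 1)) ⟨x, hx, rfl⟩
    have := hi₀ i
    linarith
  · have h1 := (hol i).2.1 a ha 0 zero_mem_sq
    have h2 := abs_sub_abs_le_abs_sub (T.gx i a) (T.gx i 0)
    have h3 := hpow a ha
    have h4 := Finset.single_le_sum (f := fun i => |T.gx i 0|) (fun i _ => abs_nonneg _)
      (Finset.mem_univ i)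
    linarith

lemma dE_Sw_le {c : ℝ} (hc0 : 0 ≤ c)
    (hc : ∀ i, ∀ a ∈ sq, ∀ b ∈ sq, dE (S T i a) (S T i b) ≤ c * dE a b)
    (w : List I) {a b : ℝ × ℝ} (ha : a ∈ sq) (hb : b ∈ sq) :
    dE (Sw T w a) (Sw T w b) ≤ 2 * c ^ w.length := by
  induction w with
  | nil => simpa [Sw] using dE_le_two ha hb
  | cons i w ih =>
    have := hc i _ (Sw_mapsTo T w ha) _ (Sw_mapsTo T w hb)
    rw [List.length_cons, pow_succ]
    simp only [Sw]
    nlinarith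

/-- Bounded distortion: differences of `S_w` along the two coordinates are controlled by the
entries of the Jacobian at any point of the unit square. -/
lemma exists_distortion : ∃ P Q : ℝ, 0 < P ∧ 0 ≤ Q ∧
    ∀ w : List I, ∀ a ∈ sq, ∀ b ∈ sq,
      |(Sw T w a).1 - (Sw T w b).1| ≤ P * |fxw T w b| * |a.1 - b.1| ∧
      |(Sw T w a).2 - (Sw T w b).2| ≤
        P * |gyw T w b| * |a.2 - b.2| + P * Q * |fxw T w b| * |a.1 - b.1| := by
  obtain ⟨c, α, H, d, κ, G, hc0, hc1, hα, hH, hd, hκ, hG0, hc, hf, hgy, hdy, hdom, hG⟩ :=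
    exists_constants T
  set lam := c ^ α with hlam
  have hlam0 : 0 ≤ lam := Real.rpow_nonneg hc0 _
  have hlam1 : lam < 1 := Real.rpow_lt_one hc0 hc1 hα
  set A := H * 2 ^ α / d with hA
  have hA0 : 0 ≤ A := by positivity
  set P : ℕ → ℝ := fun n => Real.exp (∑ k ∈ Finset.range n, A * lam ^ k) with hP
  have hPpos : ∀ n, 0 < P n := fun n => Real.exp_pos _
  have hPs : ∀ n, (1 + A * lam ^ n) * P n ≤ P (n + 1) := by
    intro n
    have h1 := Real.add_one_le_exp (A * lam ^ n)
    simp only [hP, Finset.sum_range_succ, Real.exp_add]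
    rw [mul_comm]
    gcongr
    linarith
  have hP1 : ∀ n, P n ≤ P (n + 1) := fun n => by
    have : 0 ≤ A * lam ^ n := by positivity
    nlinarith [hPs n, hPpos n]
  have hPle : ∀ n, P n ≤ Real.exp (A * (1 - lam)⁻¹) := by
    intro n
    refine Real.exp_le_exp.2 ?_
    rw [← Finset.mul_sum, ← tsum_geometric_of_lt_one hlam0 hlam1]
    gcongr
    exact (summable_geometric_of_lt_one hlam0 hlam1).sum_le_tsum _ fun i _ => by positivity
  have hpow : ∀ n (r : ℝ), 0 ≤ r → r ≤ 2 * c ^ n → ∀ y : ℝ, d ≤ y →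
      y + H * r ^ α ≤ (1 + A * lam ^ n) * y := by
    intro n r hr0 hr y hy
    have h1 : r ^ α ≤ 2 ^ α * lam ^ n := by
      refine (Real.rpow_le_rpow hr0 hr hα.le).trans_eq ?_
      rw [Real.mul_rpow (by norm_num) (by positivity), hlam, ← Real.rpow_natCast,
        ← Real.rpow_natCast, ← Real.rpow_mul hc0, ← Real.rpow_mul hc0, mul_comm (n : ℝ)]
    have h2 : H * 2 ^ α * lam ^ n ≤ A * lam ^ n * y := by
      have : H * 2 ^ α = A * d := by rw [hA]; field_simp
      rw [this]
      have : 0 ≤ A * lam ^ n := by positivity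
      nlinarith
    nlinarith
  set Q := G / κ with hQ
  have hQ0 : 0 ≤ Q := by positivity
  have hQκ : G = Q * κ := by rw [hQ]; field_simp
  have main : ∀ w : List I, ∀ a ∈ sq, ∀ b ∈ sq,
      |(Sw T w a).1 - (Sw T w b).1| ≤ P w.length * |fxw T w b| * |a.1 - b.1| ∧
      |(Sw T w a).2 - (Sw T w b).2| ≤ P w.length * |gyw T w b| * |a.2 - b.2|
        + P w.length * Q * |fxw T w b| * |a.1 - b.1| := by
    intro w a ha b hb
    induction w with
    | nil =>
      have : 0 ≤ Q * |a.1 - b.1| := by positivity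
      simpa [Sw, fxw, gyw, hP] using this
    | cons i w ih =>
      obtain ⟨ih1, ih2⟩ := ih
      have hsa := Sw_mapsTo T w ha
      have hsb := Sw_mapsTo T w hb
      have hD := dE_Sw_le T hc0 hc w ha hb
      set n := w.length
      set p := Sw T w a
      set q := Sw T w b
      have hfy := hdom i q hsb q.1 hsb.1
      have hy := hdy i q hsb
      have e0 : 0 ≤ A * lam ^ n := by positivity
      have h1 := abs_f_sub_le T hα hH i (hf i) hsa.1 hsb.1
      have h1' := hpow n |p.1 - q.1| (abs_nonneg _) ((abs_fst_sub_le_dE p q).trans hD)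
        |T.fx i q.1| (by linarith)
      have h2 := abs_g_sub_le T hα hH i (hgy i) (hG i) hsa hsb
      have h2' := hpow n (dE p q) (dE_nonneg _ _) hD |T.gy i q| hy
      set Y := |T.gy i q|
      set X := |T.fx i q.1|
      have hX0 : 0 ≤ X := abs_nonneg _
      have hY0 : 0 ≤ Y := abs_nonneg _
      have hu : 0 ≤ |fxw T w b| * |a.1 - b.1| := by positivity
      have hv : 0 ≤ |gyw T w b| * |a.2 - b.2| := by positivity
      simp only [Sw, S, fxw, gyw, abs_mul, List.length_cons]
      constructor
      · calc |T.f i p.1 - T.f i q.1| ≤ ((1 + A * lam ^ n) * X) * |p.1 - q.1| :=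
            h1.trans (mul_le_mul_of_nonneg_right h1' (abs_nonneg _))
          _ ≤ ((1 + A * lam ^ n) * X) * (P n * |fxw T w b| * |a.1 - b.1|) := by gcongr
          _ = ((1 + A * lam ^ n) * P n) * (X * (|fxw T w b| * |a.1 - b.1|)) := by ring
          _ ≤ P (n + 1) * (X * (|fxw T w b| * |a.1 - b.1|)) :=
            mul_le_mul_of_nonneg_right (hPs n) (by positivity)
          _ = _ := by ring
      · have hgap : G + (1 + A * lam ^ n) * Y * Q ≤ (1 + A * lam ^ n) * X * Q := by
          have : Y * Q + G ≤ X * Q := by rw [hQκ]; nlinarith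
          nlinarith
        calc |T.g i p - T.g i q|
            ≤ G * |p.1 - q.1| + ((1 + A * lam ^ n) * Y) * |p.2 - q.2| :=
            h2.trans (add_le_add le_rfl (mul_le_mul_of_nonneg_right h2' (abs_nonneg _)))
          _ ≤ G * (P n * |fxw T w b| * |a.1 - b.1|) + ((1 + A * lam ^ n) * Y) *
              (P n * |gyw T w b| * |a.2 - b.2| + P n * Q * |fxw T w b| * |a.1 - b.1|) := by
            gcongr
          _ = ((1 + A * lam ^ n) * P n) * (Y * (|gyw T w b| * |a.2 - b.2|)) +
              (G + (1 + A * lam ^ n) * Y * Q) * (P n * (|fxw T w b| * |a.1 - b.1|)) := by ring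
          _ ≤ P (n + 1) * (Y * (|gyw T w b| * |a.2 - b.2|)) +
              ((1 + A * lam ^ n) * X * Q) * (P n * (|fxw T w b| * |a.1 - b.1|)) :=
            add_le_add (mul_le_mul_of_nonneg_right (hPs n) (by positivity))
              (mul_le_mul_of_nonneg_right hgap (mul_nonneg (hPpos n).le hu))
          _ = P (n + 1) * (Y * (|gyw T w b| * |a.2 - b.2|)) +
              ((1 + A * lam ^ n) * P n) * (X * Q * (|fxw T w b| * |a.1 - b.1|)) := by ring
          _ ≤ P (n + 1) * (Y * (|gyw T w b| * |a.2 - b.2|)) +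
              P (n + 1) * (X * Q * (|fxw T w b| * |a.1 - b.1|)) :=
            add_le_add le_rfl (mul_le_mul_of_nonneg_right (hPs n) (by positivity))
          _ = _ := by ring
  refine ⟨Real.exp (A * (1 - lam)⁻¹), Q, Real.exp_pos _, hQ0, fun w a ha b hb => ?_⟩
  obtain ⟨h1, h2⟩ := main w a ha b hb
  refine ⟨h1.trans ?_, h2.trans ?_⟩
  · gcongr
    exact hPle _
  · gcongr <;> exact hPle _

/-- The entries of the Jacobian: the diagonal entries do not vanish, and the others are dominated
by the top-left one. -/
lemma exists_jacobian_bound : ∃ Q : ℝ, 0 ≤ Q ∧ ∀ w : List I, ∀ b ∈ sq,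
    0 < |gyw T w b| ∧ |gyw T w b| ≤ |fxw T w b| ∧ |gxw T w b| ≤ Q * |fxw T w b| := by
  obtain ⟨c, α, H, d, κ, G, hc0, hc1, hα, hH, hd, hκ, hG0, hc, hf, hgy, hdy, hdom, hG⟩ :=
    exists_constants T
  refine ⟨G / κ, by positivity, fun w b hb => ?_⟩
  have hQκ : G = G / κ * κ := by field_simp
  set Q := G / κ
  have hQ0 : 0 ≤ Q := by positivity
  induction w with
  | nil => simp [gyw, fxw, gxw, hQ0]
  | cons i w ih =>
    obtain ⟨h1, h2, h3⟩ := ih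
    have hq := Sw_mapsTo T w hb
    have hy := hdy i _ hq
    have hfy := hdom i _ hq _ hq.1
    have hg := hG i _ hq
    simp only [gyw, fxw, gxw]
    refine ⟨?_, ?_, ?_⟩
    · rw [abs_mul]
      exact mul_pos (by linarith) h1
    · rw [abs_mul, abs_mul]
      exact mul_le_mul (by linarith) h2 h1.le (abs_nonneg _)
    · refine (abs_add_le _ _).trans ?_
      rw [abs_mul, abs_mul, abs_mul]
      have hy0 := abs_nonneg (T.gy i (Sw T w b))
      set X := |T.fx i (Sw T w b).1|
      set Y := |T.gy i (Sw T w b)|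
      have hgap : G + Y * Q ≤ X * Q := by rw [hQκ]; nlinarith
      have hu := abs_nonneg (fxw T w b)
      calc |T.gx i (Sw T w b)| * |fxw T w b| + Y * |gxw T w b|
          ≤ G * |fxw T w b| + Y * (Q * |fxw T w b|) := by gcongr
        _ = (G + Y * Q) * |fxw T w b| := by ring
        _ ≤ X * Q * |fxw T w b| := by gcongr
        _ = _ := by ring

lemma sv1_mul_sv2 (A : Matrix (Fin 2) (Fin 2) ℝ) : sv1 A * sv2 A = |A.det| := by
  have hdisc : 0 ≤ frobSq A ^ 2 - 4 * A.det ^ 2 := by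
    have e : frobSq A = A 0 0 ^ 2 + A 0 1 ^ 2 + (A 1 0 ^ 2 + A 1 1 ^ 2) := by
      simp [frobSq, Fin.sum_univ_two]
    have e1 : 0 ≤ frobSq A - 2 * A.det := by
      rw [e, Matrix.det_fin_two]
      nlinarith [sq_nonneg (A 0 0 - A 1 1), sq_nonneg (A 0 1 + A 1 0)]
    have e2 : 0 ≤ frobSq A + 2 * A.det := by
      rw [e, Matrix.det_fin_two]
      nlinarith [sq_nonneg (A 0 0 + A 1 1), sq_nonneg (A 0 1 - A 1 0)]
    nlinarith [mul_nonneg e1 e2]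
  have hfrob : 0 ≤ frobSq A := by unfold frobSq; positivity
  unfold sv1 sv2
  rw [← Real.sqrt_mul (by positivity), ← Real.sqrt_sq_eq_abs]
  congr 1
  nlinarith [Real.sq_sqrt hdisc]

lemma frobSq_half_le_sv1_sq (A : Matrix (Fin 2) (Fin 2) ℝ) :
    frobSq A / 2 ≤ sv1 A ^ 2 ∧ sv1 A ^ 2 ≤ frobSq A := by
  have hfrob : 0 ≤ frobSq A := by unfold frobSq; positivity
  have h0 := Real.sqrt_nonneg (frobSq A ^ 2 - 4 * A.det ^ 2)
  have h1 : Real.sqrt (frobSq A ^ 2 - 4 * A.det ^ 2) ≤ frobSq A :=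
    Real.sqrt_le_iff.2 ⟨hfrob, by nlinarith [sq_nonneg A.det]⟩
  unfold sv1
  rw [Real.sq_sqrt (by positivity)]
  constructor <;> linarith

/-- The logarithms of the singular values agree with those of the diagonal entries, up to a
bounded error. -/
lemma exists_log_alpha_bound : ∃ C : ℝ, ∀ w : List I, ∀ b ∈ sq,
    |Real.log (alpha1 T w b) - Real.log (|fxw T w b|)| ≤ C ∧
    |Real.log (alpha2 T w b) - Real.log (|gyw T w b|)| ≤ C := by
  obtain ⟨Q, hQ, hJ⟩ := exists_jacobian_bound T
  refine ⟨Real.log (2 + Q ^ 2) / 2 + Real.log 2 / 2, fun w b hb => ?_⟩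
  obtain ⟨hg, hgf, hx⟩ := hJ w b hb
  have hf : 0 < |fxw T w b| := hg.trans_le hgf
  have hdet : alpha1 T w b * alpha2 T w b = |fxw T w b| * |gyw T w b| := by
    rw [alpha1, alpha2, sv1_mul_sv2, Dmat, Matrix.det_fin_two_of, ← abs_mul]
    simp
  obtain ⟨hl, hu⟩ := frobSq_half_le_sv1_sq (Dmat T w b)
  have hfr : frobSq (Dmat T w b) = |fxw T w b| ^ 2 + |gxw T w b| ^ 2 + |gyw T w b| ^ 2 := by
    simp [frobSq, Dmat, Fin.sum_univ_two]
    ring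
  have hl' : |fxw T w b| ^ 2 / 2 ≤ alpha1 T w b ^ 2 := by
    have : alpha1 T w b = sv1 (Dmat T w b) := rfl
    rw [this]
    nlinarith [sq_nonneg |gxw T w b|, sq_nonneg |gyw T w b|]
  have hu' : alpha1 T w b ^ 2 ≤ (2 + Q ^ 2) * |fxw T w b| ^ 2 := by
    have : alpha1 T w b = sv1 (Dmat T w b) := rfl
    have h1 : (|gxw T w b|) ^ 2 ≤ (Q * |fxw T w b|) ^ 2 := by gcongr
    have h2 : (|gyw T w b|) ^ 2 ≤ (|fxw T w b|) ^ 2 := by gcongr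
    rw [this]
    nlinarith
  have ha0 : 0 ≤ alpha1 T w b := Real.sqrt_nonneg _
  have ha : 0 < alpha1 T w b := by
    rcases ha0.eq_or_lt with h | h
    · rw [← h] at hl'
      nlinarith [sq_pos_of_pos hf]
    · exact h
  have ha2 : 0 < alpha2 T w b := by
    have : 0 < alpha1 T w b * alpha2 T w b := hdet ▸ mul_pos hf hg
    exact (mul_pos_iff_of_pos_left ha).1 this
  have hlog := congrArg Real.log hdet
  rw [Real.log_mul ha.ne' ha2.ne', Real.log_mul hf.ne' hg.ne'] at hlog
  have L1 := Real.log_le_log (by positivity) hl'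
  have L2 := Real.log_le_log (by positivity) hu'
  rw [Real.log_div (by positivity) (by norm_num), Real.log_pow, Real.log_pow] at L1
  rw [Real.log_mul (by positivity) (by positivity), Real.log_pow, Real.log_pow] at L2
  have hQl : 0 ≤ Real.log (2 + Q ^ 2) := Real.log_nonneg (by nlinarith [sq_nonneg Q])
  have h2l : 0 ≤ Real.log 2 := Real.log_nonneg (by norm_num)
  push_cast at L1 L2
  rw [abs_le, abs_le]
  refine ⟨⟨?_, ?_⟩, ?_, ?_⟩ <;> linarith

end Geometry

end FFL

namespace FFL

section Words

variable {I : Type}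

lemma word_length (ii : ℕ → I) (n : ℕ) : (word ii n).length = n := by simp [word]

lemma mem_cyl_iff {w : List I} {jj : ℕ → I} : jj ∈ cyl w ↔ word jj w.length = w := by
  constructor
  · intro h
    refine List.ext_getElem (by simp [word]) fun k h1 h2 => ?_
    simpa [word] using h ⟨k, h2⟩
  · intro h k
    have := List.getElem_of_eq h (i := k) (by simp [word])
    simpa [word] using this

lemma mem_cyl_word (ii : ℕ → I) (n : ℕ) : ii ∈ cyl (word ii n) := by
  rw [mem_cyl_iff, word_length]

lemma word_add (ii : ℕ → I) (n k : ℕ) :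
    word ii (n + k) = word ii n ++ word (shiftn ii n) k := by
  simp only [word, shiftn, List.ofFn_add]
  congr 2
  ext j
  simp [add_comm]

lemma mem_cyl_append {w v : List I} {jj : ℕ → I} :
    jj ∈ cyl (w ++ v) ↔ jj ∈ cyl w ∧ shiftn jj w.length ∈ cyl v := by
  rw [mem_cyl_iff, mem_cyl_iff, mem_cyl_iff, List.length_append, word_add]
  exact ⟨fun h => List.append_inj h (word_length _ _), fun h => by rw [h.1, h.2]⟩

lemma shift_iterate (ii : ℕ → I) (n : ℕ) : shift^[n] ii = shiftn ii n := by
  induction n with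
  | zero => rfl
  | succ n ih =>
    rw [Function.iterate_succ_apply', ih]
    ext k
    simp only [shift, shiftn]
    congr 1
    ring

lemma measurableSet_cyl [MeasurableSpace I] [MeasurableSingletonClass I] (w : List I) :
    MeasurableSet (cyl w) := by
  have : cyl w = ⋂ k : Fin w.length, (fun jj : ℕ → I => jj k.1) ⁻¹' {w.get k} := by
    ext jj
    simp [cyl]
  rw [this]
  exact MeasurableSet.iInter fun k => measurable_pi_apply _ (measurableSet_singleton _)

lemma QuasiBernoulli.sum_le [MeasurableSpace I] [MeasurableSingletonClass I]
    {m : Measure (ℕ → I)} [IsFiniteMeasure m] {L : ℝ} (hQB : QuasiBernoulli m L) (w : List I)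
    {N : ℕ} (W : Finset (Fin N → I)) {A : Set (ℕ → I)}
    (hA : ∀ v ∈ W, cyl (w ++ List.ofFn v) ⊆ A) :
    L⁻¹ * (m (cyl w)).toReal * ∑ v ∈ W, (m (cyl (List.ofFn v))).toReal ≤ (m A).toReal := by
  rw [Finset.mul_sum]
  refine (Finset.sum_le_sum fun v _ => (hQB.2 w (List.ofFn v)).1).trans ?_
  have hdisj : (W : Set (Fin N → I)).PairwiseDisjoint fun v => cyl (w ++ List.ofFn v) := by
    intro v _ v' _ hne
    refine Set.disjoint_left.2 fun jj h h' => hne ?_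
    rw [mem_cyl_iff] at h h'
    simp only [List.length_append, List.length_ofFn] at h h'
    exact List.ofFn_injective (List.append_cancel_left (h.symm.trans h'))
  have := measureReal_biUnion_finset (μ := m) hdisj fun v _ => measurableSet_cyl _
  simp only [measureReal_def] at this
  rw [← this]
  exact measureReal_mono (iUnion₂_subset hA)

end Words

lemma measurableSet_setOf_dE_le (r : ℝ) :
    MeasurableSet {p : (ℝ × ℝ) × (ℝ × ℝ) | dE p.1 p.2 ≤ r} :=
  (isClosed_le continuous_dE continuous_const).measurableSet

lemma measurableSet_ballE (x : ℝ × ℝ) (r : ℝ) : MeasurableSet (ballE x r) :=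
  measurable_prodMk_left (measurableSet_setOf_dE_le r)

section Coding

variable {I : Type} [Fintype I] {T : System I} {Pi : (ℕ → I) → ℝ × ℝ}

lemma IsCoding.mem_sq (hPi : IsCoding T Pi) (ii : ℕ → I) : Pi ii ∈ sq := by
  simpa [word, Sw] using hPi ii 0

lemma IsCoding.dE_le {c : ℝ} (hPi : IsCoding T Pi) (hc0 : 0 ≤ c)
    (hc : ∀ i, ∀ a ∈ sq, ∀ b ∈ sq, dE (S T i a) (S T i b) ≤ c * dE a b)
    {v : List I} {jj jj' : ℕ → I} (h : jj ∈ cyl v) (h' : jj' ∈ cyl v) :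
    dE (Pi jj) (Pi jj') ≤ 2 * c ^ v.length := by
  obtain ⟨a, ha, e⟩ := hPi jj v.length
  obtain ⟨b, hb, e'⟩ := hPi jj' v.length
  rw [mem_cyl_iff.1 h] at e
  rw [mem_cyl_iff.1 h'] at e'
  rw [← e, ← e']
  exact dE_Sw_le T hc0 hc v ha hb

lemma tendsto_two_mul_pow {c : ℝ} (hc0 : 0 ≤ c) (hc1 : c < 1) :
    Tendsto (fun n : ℕ => 2 * c ^ n) atTop (nhds 0) := by
  simpa using (tendsto_pow_atTop_nhds_zero_of_lt_one hc0 hc1).const_mul 2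

lemma IsCoding.eq_Sw (hPi : IsCoding T Pi) (ii : ℕ → I) (n : ℕ) :
    Pi ii = Sw T (word ii n) (Pi (shiftn ii n)) := by
  obtain ⟨c, α, H, d, κ, G, hc0, hc1, hα, hH, hd, hκ, hG0, hc, -⟩ := exists_constants T
  refine dist_le_zero.1 (ge_of_tendsto ((tendsto_two_mul_pow hc0 hc1).comp
    (tendsto_add_atTop_nat n)) (Eventually.of_forall fun k => ?_))
  refine (dist_le_dE _ _).trans ?_
  obtain ⟨a, ha, e⟩ := hPi ii (n + k)
  obtain ⟨b, hb, e'⟩ := hPi (shiftn ii n) k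
  rw [← e, ← e', ← Sw_append, ← word_add]
  have := dE_Sw_le T hc0 hc (word ii (n + k)) ha hb
  rw [word_length] at this
  rwa [Function.comp_apply, add_comm k n]

lemma continuousOn_S (T : System I) (i : I) : ContinuousOn (S T i) sq := fun a ha =>
  ContinuousWithinAt.prodMk
    ((T.hasDeriv_f i a.1 ha.1).continuousWithinAt.comp continuousWithinAt_fst fun _ hb => hb.1)
    (T.hasDeriv_g i a ha).continuousWithinAt

lemma IsCoding.mem_attractor (hPi : IsCoding T Pi) {F : Set (ℝ × ℝ)} (hF : IsAttractor T F)
    (ii : ℕ → I) : Pi ii ∈ F := by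
  obtain ⟨hne, hcomp, hsub, heq⟩ := hF
  obtain ⟨c, α, H, d, κ, G, hc0, hc1, hα, hH, hd, hκ, hG0, hc, -⟩ := exists_constants T
  have hSF : ∀ (w : List I), ∀ a ∈ F, Sw T w a ∈ F := by
    intro w a ha
    induction w with
    | nil => exact ha
    | cons i w ih =>
      rw [heq]
      exact mem_iUnion.2 ⟨i, _, ih, rfl⟩
  obtain ⟨x, hx⟩ := hne
  rw [← hcomp.isClosed.closure_eq]
  refine mem_closure_of_tendsto (f := fun n => Sw T (word ii n) x) (b := atTop) ?_
    (Eventually.of_forall fun n => hSF _ x hx)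
  refine tendsto_iff_dist_tendsto_zero.2 (squeeze_zero (fun _ => dist_nonneg) (fun n => ?_)
    (tendsto_two_mul_pow hc0 hc1))
  obtain ⟨a, ha, e⟩ := hPi ii n
  rw [← e]
  have := dE_Sw_le T hc0 hc (word ii n) (hsub hx) ha
  rw [word_length] at this
  exact (dist_le_dE _ _).trans this

/-- Under strong separation, measurability of the coding map forces singletons of the alphabet
to be measurable. -/
lemma IsCoding.measurableSingletonClass [MeasurableSpace I] (hPi : IsCoding T Pi)
    (hPim : Measurable Pi) {F : Set (ℝ × ℝ)} (hF : IsAttractor T F) (hSSC : SSC T F) :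
    MeasurableSingletonClass I := by
  have hmem : ∀ jj, Pi jj ∈ S T (jj 0) '' F := fun jj =>
    ⟨Pi (shiftn jj 1), hPi.mem_attractor hF _, by simpa [word, Sw] using (hPi.eq_Sw jj 1).symm⟩
  refine ⟨fun i => ?_⟩
  have hmeas : MeasurableSet (S T i '' F) :=
    (hF.2.1.image_of_continuousOn ((continuousOn_S T i).mono hF.2.2.1)).isClosed.measurableSet
  have hconst : Measurable fun j : I => (fun _ : ℕ => j) :=
    measurable_pi_lambda _ fun _ => measurable_id
  convert hconst (hPim hmeas) using 1
  ext j
  simp only [mem_singleton_iff, mem_preimage]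
  constructor
  · rintro rfl
    exact hmem fun _ => j
  · intro h
    by_contra hne
    exact Set.disjoint_left.1 (hSSC j i hne) (hmem fun _ => j) h

/-- Lower bound for the measure of a ball of radius comparable to the shorter side of a cylinder,
in terms of the projected measure at the scale of the eccentricity of that cylinder. -/
lemma exists_ball_lower_bound [MeasurableSpace I] [MeasurableSingletonClass I]
    (hPi : IsCoding T Pi) (hPim : Measurable Pi) (m : Measure (ℕ → I)) [IsProbabilityMeasure m]
    {L : ℝ} (hQB : QuasiBernoulli m L) :
    ∃ C > (0:ℝ), ∀ (ii : ℕ → I) (n : ℕ) (ρ : ℝ), 0 < ρ →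
      |fxw T (word ii n) (Pi (shiftn ii n))| * ρ ≤ |gyw T (word ii n) (Pi (shiftn ii n))| →
      L⁻¹ * (m (cyl (word ii n))).toReal *
          (((m.map Pi).map Prod.fst) (Metric.closedBall (Pi (shiftn ii n)).1 ρ)).toReal ≤
        ((m.map Pi) (ballE (Pi ii) (C * |gyw T (word ii n) (Pi (shiftn ii n))|))).toReal := by
  obtain ⟨c, α, H, d, κ, G, hc0, hc1, hα, hH, hd, hκ, hG0, hc, -⟩ := exists_constants T
  obtain ⟨P, Q, hP, hQ, hdist⟩ := exists_distortion T
  refine ⟨2 * P + P + 2 * P * Q, by positivity, fun ii n ρ hρ hle => ?_⟩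
  set b := Pi (shiftn ii n)
  set w := word ii n
  have hbsq : b ∈ sq := hPi.mem_sq _
  obtain ⟨N, hN⟩ := ((tendsto_two_mul_pow hc0 hc1).eventually_lt_const hρ).exists
  set U : Set (ℕ → I) := Pi ⁻¹' (Prod.fst ⁻¹' Metric.closedBall b.1 ρ) with hU
  rw [Measure.map_apply measurable_fst Metric.isClosed_closedBall.measurableSet,
    Measure.map_apply hPim (measurable_fst Metric.isClosed_closedBall.measurableSet),
    Measure.map_apply hPim (measurableSet_ballE _ _)]
  classical
  set W : Finset (Fin N → I) := Finset.univ.filter fun v => (cyl (List.ofFn v) ∩ U).Nonempty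
  have hUW : (m U).toReal ≤ ∑ v ∈ W, (m (cyl (List.ofFn v))).toReal := by
    refine le_trans ?_ (measureReal_biUnion_finset_le W fun v => cyl (List.ofFn v))
    refine measureReal_mono (fun jj hjj => ?_) (measure_ne_top _ _)
    have hjc : jj ∈ cyl (List.ofFn fun k : Fin N => jj k) := mem_cyl_word jj N
    exact mem_iUnion₂.2 ⟨fun k => jj k, Finset.mem_filter.2 ⟨Finset.mem_univ _, jj, hjc, hjj⟩, hjc⟩
  have hL := hQB.1
  refine le_trans (mul_le_mul_of_nonneg_left hUW (by positivity)) (hQB.sum_le w W ?_)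
  intro v hv jj hjj
  obtain ⟨jj', hjv, hjU⟩ := (Finset.mem_filter.1 hv).2
  obtain ⟨hw, hv'⟩ := mem_cyl_append.1 hjj
  have hwl : w.length = n := word_length ii n
  have hjw : word jj n = w := by
    rw [← hwl]
    exact mem_cyl_iff.1 hw
  rw [hwl] at hv'
  have h1 : |(Pi (shiftn jj n)).1 - b.1| ≤ 2 * ρ := by
    have e1 := (abs_fst_sub_le_dE _ _).trans (hPi.dE_le hc0 hc hv' hjv)
    rw [List.length_ofFn] at e1
    have e2 : |(Pi jj').1 - b.1| ≤ ρ := by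
      have := hjU
      rwa [hU, mem_preimage, mem_preimage, Metric.mem_closedBall, Real.dist_eq] at this
    have := abs_sub_le (Pi (shiftn jj n)).1 (Pi jj').1 b.1
    linarith
  have h2 := abs_sub_le_one (hPi.mem_sq (shiftn jj n)).2 hbsq.2
  obtain ⟨d1, d2⟩ := hdist w _ (hPi.mem_sq (shiftn jj n)) b hbsq
  show dE (Pi ii) (Pi jj) ≤ _
  rw [hPi.eq_Sw ii n, hPi.eq_Sw jj n, hjw]
  refine (dE_le_add _ _).trans ?_
  rw [abs_sub_comm, abs_sub_comm (Sw T w b).2]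
  have h3 : |fxw T w b| * |(Pi (shiftn jj n)).1 - b.1| ≤ 2 * |gyw T w b| := by
    nlinarith [mul_le_mul_of_nonneg_left h1 (abs_nonneg (fxw T w b))]
  have h4 : |gyw T w b| * |(Pi (shiftn jj n)).2 - b.2| ≤ |gyw T w b| :=
    mul_le_of_le_one_right (abs_nonneg _) h2
  have h5 := mul_le_mul_of_nonneg_left h3 hP.le
  have h6 := mul_le_mul_of_nonneg_left h3 (mul_nonneg hP.le hQ)
  have h7 := mul_le_mul_of_nonneg_left h4 hP.le
  nlinarith

end Coding

end FFL

namespace FFL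

section Recurrence

variable {X : Type*} [MeasurableSpace X] {f : X → X} {m : Measure X} [IsProbabilityMeasure m]
  {K : Set X}

/-- A form of Kac's lemma: the tails of the first return time to `K` are summable. -/
lemma tsum_measure_no_return_ne_top (hf : MeasurePreserving f m m) (hK : MeasurableSet K) :
    ∑' n : ℕ, m {x | x ∈ K ∧ ∀ l, 1 ≤ l → l ≤ n → f^[l] x ∉ K} ≠ ⊤ := by
  set B : ℕ → Set X := fun n => {x | ∀ l < n, f^[l] x ∉ K} with hB
  have hBm : ∀ n, MeasurableSet (B n) := by
    intro n
    have : B n = ⋂ l, ⋂ (_ : l < n), (f^[l] ⁻¹' K)ᶜ := by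
      ext x
      simp [hB]
    rw [this]
    exact MeasurableSet.iInter fun l => MeasurableSet.iInter fun _ =>
      (hf.measurable.iterate l hK).compl
  have hstep : ∀ n, m {x | x ∈ K ∧ ∀ l, 1 ≤ l → l ≤ n → f^[l] x ∉ K} + m (B (n + 1))
      = m (B n) := by
    intro n
    rw [← hf.measure_preimage (hBm n).nullMeasurableSet, ← measure_union _ (hBm (n + 1))]
    · congr 1
      ext x
      simp only [hB, mem_union, mem_ofPred_eq, mem_preimage, ← Function.iterate_succ_apply]
      constructor
      · rintro (⟨-, h⟩ | h) l hl
        · exact h _ (by omega) (by omega)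
        · exact h _ (by omega)
      · intro h
        have h' : ∀ l, 1 ≤ l → l ≤ n → f^[l] x ∉ K := fun l h1 h2 => by
          obtain ⟨l, rfl⟩ := Nat.exists_eq_add_of_le' h1
          exact h l (by omega)
        by_cases hx : x ∈ K
        · exact Or.inl ⟨hx, h'⟩
        · refine Or.inr fun l hl => ?_
          rcases Nat.eq_zero_or_pos l with rfl | hl0
          · simpa using hx
          · exact h' l hl0 (by omega)
    · rw [Set.disjoint_left]
      rintro x ⟨hx, -⟩ h
      exact h 0 (Nat.succ_pos n) hx
  have hsum : ∀ n, ∑ k ∈ Finset.range n, m {x | x ∈ K ∧ ∀ l, 1 ≤ l → l ≤ k → f^[l] x ∉ K}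
      + m (B n) = 1 := by
    intro n
    induction n with
    | zero => simp [hB]
    | succ n ih => rw [Finset.sum_range_succ, add_assoc, hstep, ih]
  refine ne_top_of_le_ne_top ENNReal.one_ne_top (ENNReal.tsum_le_of_sum_range_le fun n => ?_)
  exact (hsum n).le.trans' le_self_add

lemma tsum_comp_div_ne_top {u : ℕ → ENNReal} (hu : ∑' n, u n ≠ ⊤) {k : ℕ} (hk : k ≠ 0) :
    ∑' n, u (n / k) ≠ ⊤ := by
  have : NeZero k := ⟨hk⟩
  rw [← (Nat.divModEquiv k).symm.tsum_eq, ENNReal.tsum_prod']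
  have h : ∀ (a : ℕ) (b : Fin k), (Nat.divModEquiv k).symm (a, b) / k = a := by
    intro a b
    have := congrArg Prod.fst ((Nat.divModEquiv k).apply_symm_apply (a, b))
    simpa using this
  simp only [h, ENNReal.tsum_const, ENNReal.tsum_mul_left]
  exact ENNReal.mul_ne_top (by simp) hu

/-- Under an ergodic map, the visits of almost every orbit to a set of positive measure have
sublinear gaps. -/
lemma ae_exists_visit_of_ergodic (hf : Ergodic f m) (hK : MeasurableSet K) (hK0 : m K ≠ 0) :
    ∀ᵐ x ∂m, ∀ ε > (0:ℝ), ∀ᶠ n : ℕ in atTop, ∃ n' : ℕ, n ≤ n' ∧ (n' : ℝ) ≤ (1 + ε) * n ∧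
      f^[n'] x ∈ K := by
  have hmp := hf.toMeasurePreserving
  have hAm : ∀ n, MeasurableSet {x | x ∈ K ∧ ∀ l, 1 ≤ l → l ≤ n → f^[l] x ∉ K} := by
    intro n
    have : {x | x ∈ K ∧ ∀ l, 1 ≤ l → l ≤ n → f^[l] x ∉ K}
        = K ∩ ⋂ l, ⋂ (_ : 1 ≤ l), ⋂ (_ : l ≤ n), (f^[l] ⁻¹' K)ᶜ := by
      ext x
      simp
    rw [this]
    exact hK.inter <| MeasurableSet.iInter fun l => MeasurableSet.iInter fun _ =>
      MeasurableSet.iInter fun _ => (hmp.measurable.iterate l hK).compl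
  have hfreq : ∀ᵐ x ∂m, ∃ᶠ n in atTop, f^[n] x ∈ K := by
    have hEm : MeasurableSet {x | ∃ᶠ n in atTop, f^[n] x ∈ K} := by
      have : {x | ∃ᶠ n in atTop, f^[n] x ∈ K} = ⋂ N : ℕ, ⋃ n : ℕ, ⋃ (_ : N ≤ n), f^[n] ⁻¹' K := by
        ext x
        simp [frequently_atTop]
      rw [this]
      exact MeasurableSet.iInter fun N => MeasurableSet.iUnion fun n =>
        MeasurableSet.iUnion fun _ => hmp.measurable.iterate n hK
    have hinv : f ⁻¹' {x | ∃ᶠ n in atTop, f^[n] x ∈ K} = {x | ∃ᶠ n in atTop, f^[n] x ∈ K} := by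
      ext x
      simp only [mem_preimage, mem_ofPred_eq, ← Function.iterate_succ_apply]
      simp only [frequently_atTop]
      constructor
      · intro h N
        obtain ⟨n, hn, hx⟩ := h N
        exact ⟨n + 1, by omega, hx⟩
      · intro h N
        obtain ⟨n, hn, hx⟩ := h (N + 1)
        refine ⟨n - 1, by omega, ?_⟩
        rwa [show (n - 1).succ = n by omega]
    rcases hf.toPreErgodic.ae_mem_or_ae_notMem hEm hinv with h | h
    · exact h
    · refine absurd ?_ hK0
      have hrec := hmp.conservative.ae_mem_imp_frequently_image_mem hK.nullMeasurableSet
      rw [← compl_compl K]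
      change ∀ᵐ x ∂m, x ∈ Kᶜ
      filter_upwards [h, hrec] with x h1 h2 hx
      exact h1 (h2 hx)
  have hev : ∀ᵐ x ∂m, ∀ k : ℕ, ∀ᶠ n : ℕ in atTop,
      ¬ (f^[n] x ∈ K ∧ ∀ l, 1 ≤ l → l ≤ n / (k + 1) → f^[l] (f^[n] x) ∉ K) := by
    rw [ae_all_iff]
    intro k
    refine ae_eventually_notMem (s := fun n => f^[n] ⁻¹'
      {x | x ∈ K ∧ ∀ l, 1 ≤ l → l ≤ n / (k + 1) → f^[l] x ∉ K}) ?_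
    simp only [fun n => (hmp.iterate n).measure_preimage (hAm (n / (k + 1))).nullMeasurableSet]
    exact tsum_comp_div_ne_top (tsum_measure_no_return_ne_top hmp hK) k.succ_ne_zero
  filter_upwards [hfreq, hev] with x hx1 hx2 ε hε
  classical
  obtain ⟨k, hk⟩ := exists_nat_one_div_lt hε
  obtain ⟨N, hN⟩ := eventually_atTop.1 (hx2 k)
  obtain ⟨M, hNM, hM⟩ := frequently_atTop.1 hx1 N
  filter_upwards [eventually_ge_atTop M] with n hn
  set n₀ := Nat.findGreatest (fun j => f^[j] x ∈ K) n with hn₀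
  have h1 : f^[n₀] x ∈ K := Nat.findGreatest_spec (P := fun j => f^[j] x ∈ K) hn hM
  have h2 : M ≤ n₀ := Nat.le_findGreatest hn hM
  have h3 : n₀ ≤ n := Nat.findGreatest_le n
  have h4 := hN n₀ (hNM.trans h2)
  push Not at h4
  obtain ⟨l, hl1, hl2, hl⟩ := h4 h1
  rw [← Function.iterate_add_apply] at hl
  refine ⟨l + n₀, ?_, ?_, hl⟩
  · by_contra! hlt
    exact Nat.findGreatest_is_greatest (P := fun j => f^[j] x ∈ K) (n := n) (k := l + n₀)
      (by omega) hlt.le hl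
  · have h5 : (l : ℝ) ≤ ε * n := by
      calc (l : ℝ) ≤ ((n₀ / (k + 1) : ℕ) : ℝ) := by exact_mod_cast hl2
        _ ≤ (n₀ : ℝ) / ((k + 1 : ℕ) : ℝ) := Nat.cast_div_le
        _ = 1 / ((k : ℝ) + 1) * n₀ := by push_cast; ring
        _ ≤ ε * n := by gcongr
    have h6 : (n₀ : ℝ) ≤ n := by exact_mod_cast h3
    push_cast
    linarith

end Recurrence

/-- If a monotone function is at least `exp (φ n)` at `exp (β n)` along a set of integers `n` with
sublinear gaps, then its growth at `0` is controlled by the ratio of the rates of `φ` and `β`. -/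
lemma eventually_exp_mul_log_le {M : ℝ → ℝ} (hM : Monotone M) {β φ : ℕ → ℝ} {V : Set ℕ}
    {χ ψ : ℝ} (hχ : χ < 0) (hψ : ψ ≤ 0)
    (hβ : Tendsto (fun n : ℕ => β n / n) atTop (nhds χ))
    (hφ : Tendsto (fun n : ℕ => φ n / n) atTop (nhds ψ))
    (hV : ∀ ε > (0:ℝ), ∀ᶠ n : ℕ in atTop, ∃ n' : ℕ, n ≤ n' ∧ (n' : ℝ) ≤ (1 + ε) * n ∧ n' ∈ V)
    (hle : ∀ n ∈ V, Real.exp (φ n) ≤ M (Real.exp (β n))) {δ : ℝ} (hδ : 0 < δ) :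
    ∀ᶠ r in nhdsWithin 0 (Set.Ioi 0), Real.exp ((ψ / χ + δ) * Real.log r) ≤ M r := by
  obtain ⟨ε, hε0, hεχ, hεψ⟩ : ∃ ε > (0:ℝ), χ + ε < 0 ∧
      (1 + ε) * (ψ - ε) / (χ + ε) < ψ / χ + δ := by
    have hc : ContinuousAt (fun ε : ℝ => (1 + ε) * (ψ - ε) / (χ + ε)) 0 :=
      ContinuousAt.div (by fun_prop) (by fun_prop) (by simpa using hχ.ne)
    have h1 : ∀ᶠ ε in nhds (0:ℝ), (1 + ε) * (ψ - ε) / (χ + ε) < ψ / χ + δ :=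
      hc.eventually_lt_const (by simpa using hδ)
    have h2 : ∀ᶠ ε in nhds (0:ℝ), χ + ε < 0 :=
      (eventually_lt_nhds (show (0:ℝ) < -χ by linarith)).mono fun ε h => by linarith
    obtain ⟨ε, ⟨h1, h2⟩, h3⟩ := (((h1.and h2).filter_mono nhdsWithin_le_nhds).and
      (self_mem_nhdsWithin : Set.Ioi (0:ℝ) ∈ nhdsWithin 0 (Set.Ioi 0))).exists
    exact ⟨ε, h3, h2, h1⟩
  have e1 : ∀ᶠ n : ℕ in atTop, β n ≤ n * (χ + ε) := by
    filter_upwards [hβ.eventually_lt_const (show χ < χ + ε by linarith), eventually_gt_atTop 0]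
      with n hn hn0
    have : (0:ℝ) < n := by exact_mod_cast hn0
    rw [div_lt_iff₀ this] at hn
    linarith
  have e2 : ∀ᶠ n : ℕ in atTop, n * (ψ - ε) ≤ φ n := by
    filter_upwards [hφ.eventually_const_lt (show ψ - ε < ψ by linarith), eventually_gt_atTop 0]
      with n hn hn0
    have : (0:ℝ) < n := by exact_mod_cast hn0
    rw [lt_div_iff₀ this] at hn
    linarith
  have e3 := (eventually_forall_ge_atTop.2 (e1.and e2)).and (hV ε hε0)
  have hlog := Real.tendsto_log_nhdsGT_zero
  have hceil : Tendsto (fun r : ℝ => ⌈Real.log r / (χ + ε)⌉₊) (nhdsWithin 0 (Set.Ioi 0)) atTop :=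
    by
    simp only [div_eq_mul_inv]
    exact tendsto_nat_ceil_atTop.comp
      ((tendsto_mul_const_atTop_of_neg (inv_lt_zero.2 hεχ)).2 hlog)
  have hlim : ∀ᶠ r in nhdsWithin (0:ℝ) (Set.Ioi 0),
      (1 + ε) * (ψ - ε) / (χ + ε) + (1 + ε) * (ψ - ε) * (Real.log r)⁻¹ < ψ / χ + δ := by
    have : Tendsto (fun r => (1 + ε) * (ψ - ε) / (χ + ε) + (1 + ε) * (ψ - ε) * (Real.log r)⁻¹)
        (nhdsWithin (0:ℝ) (Set.Ioi 0))
        (nhds ((1 + ε) * (ψ - ε) / (χ + ε) + (1 + ε) * (ψ - ε) * 0)) :=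
      tendsto_const_nhds.add (tendsto_const_nhds.mul (tendsto_inv_atBot_zero.comp hlog))
    exact this.eventually_lt_const (by simpa using hεψ)
  filter_upwards [hceil.eventually e3, hlim, hlog.eventually_lt_atBot 0, self_mem_nhdsWithin]
    with r hr hr2 hq hr0
  set q := Real.log r
  set n := ⌈q / (χ + ε)⌉₊
  obtain ⟨h1, n', hn, hn', hmem⟩ := hr
  obtain ⟨hb, hp⟩ := h1 n' hn
  have hn1 : q / (χ + ε) ≤ n := Nat.le_ceil _
  have hn2 : (n : ℝ) < q / (χ + ε) + 1 := Nat.ceil_lt_add_one (div_nonneg_of_nonpos hq.le hεχ.le)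
  have hnn : (n : ℝ) ≤ n' := by exact_mod_cast hn
  have hβq : β n' ≤ q := by
    have : n * (χ + ε) ≤ q := (div_le_iff_of_neg hεχ).1 hn1
    nlinarith
  have hφq : (ψ / χ + δ) * q ≤ φ n' := by
    have h2 : (n' : ℝ) ≤ (1 + ε) * (q / (χ + ε) + 1) := by nlinarith
    have h3 : (1 + ε) * (q / (χ + ε) + 1) * (ψ - ε) ≤ n' * (ψ - ε) :=
      mul_le_mul_of_nonpos_right h2 (by linarith)
    have h4 := mul_le_mul_of_nonpos_right hr2.le hq.le
    have h5 : ((1 + ε) * (ψ - ε) / (χ + ε) + (1 + ε) * (ψ - ε) * q⁻¹) * q =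
        (1 + ε) * (q / (χ + ε) + 1) * (ψ - ε) := by
      field_simp [hq.ne, hεχ.ne]
    linarith
  calc Real.exp ((ψ / χ + δ) * q) ≤ Real.exp (φ n') := Real.exp_le_exp.2 hφq
    _ ≤ M (Real.exp (β n')) := hle n' hmem
    _ ≤ M (Real.exp q) := hM (Real.exp_le_exp.2 hβq)
    _ = M r := by rw [Real.exp_log hr0]

end FFL

namespace FFL

section LocalDimension

lemma eventually_log_measure_div_log_nonneg {X : Type*} [MeasurableSpace X] (ν : Measure X)
    [IsProbabilityMeasure ν] (B : ℝ → Set X) :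
    ∀ᶠ r in nhdsWithin 0 (Set.Ioi 0), 0 ≤ Real.log (ν (B r)).toReal / Real.log r := by
  filter_upwards [Real.tendsto_log_nhdsGT_zero.eventually_lt_atBot 0] with r hr
  exact div_nonneg_of_nonpos (Real.log_nonpos ENNReal.toReal_nonneg (measureReal_le_one)) hr.le

lemma ExactDim1.nonneg {ν : Measure ℝ} [IsProbabilityMeasure ν] {t : ℝ} (hν : ExactDim1 ν t) :
    0 ≤ t := by
  obtain ⟨x, hx⟩ := hν.exists
  exact ge_of_tendsto hx (eventually_log_measure_div_log_nonneg ν _)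

lemma tendsto_exp_neg_nat_mul {a : ℝ} (ha : 0 < a) :
    Tendsto (fun k : ℕ => Real.exp (-(k * a))) atTop (nhdsWithin 0 (Set.Ioi 0)) :=
  Real.tendsto_exp_atBot_nhdsGT.comp
    (tendsto_neg_atTop_atBot.comp (tendsto_natCast_atTop_atTop.atTop_mul_const ha))

/-- An exact dimensional measure satisfies uniform polynomial lower bounds on dyadic scales. -/
lemma ExactDim1.ae_exists_exp_le {ν : Measure ℝ} [IsProbabilityMeasure ν] {t s : ℝ}
    (hν : ExactDim1 ν t) (hts : t < s) :
    ∀ᵐ x ∂ν, ∃ N : ℕ, ∀ k : ℕ, Real.exp (-((k + N) * (s * Real.log 2))) ≤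
      (ν (Metric.closedBall x (Real.exp (-(k * Real.log 2))))).toReal := by
  have hs : 0 ≤ s := hν.nonneg.trans hts.le
  have h2 : 0 < Real.log 2 := Real.log_pos (by norm_num)
  filter_upwards [hν, ν.support_mem_ae] with x hx hsupp
  have hpos : ∀ r > 0, 0 < (ν (Metric.closedBall x r)).toReal := fun r hr =>
    ENNReal.toReal_pos
      ((Measure.mem_support_iff_forall x).1 hsupp _ (Metric.closedBall_mem_nhds x hr)).ne'
      (measure_ne_top _ _)
  obtain ⟨N, hN⟩ := eventually_atTop.1 (((tendsto_exp_neg_nat_mul h2).eventually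
    (hx.eventually_lt_const hts)).and (eventually_gt_atTop 0))
  have hbig : ∀ k : ℕ, N ≤ k → Real.exp (-(k * (s * Real.log 2))) ≤
      (ν (Metric.closedBall x (Real.exp (-(k * Real.log 2))))).toReal := by
    intro k hk
    obtain ⟨h, hk0⟩ := hN k hk
    have hk0' : (0:ℝ) < k := by exact_mod_cast hk0
    rw [Real.log_exp, div_lt_iff_of_neg (by linarith [mul_pos hk0' h2])] at h
    refine (Real.le_log_iff_exp_le (hpos _ (Real.exp_pos _))).1 ?_
    linarith
  refine ⟨N, fun k => ?_⟩
  have hsl : 0 ≤ s * Real.log 2 := by positivity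
  rcases le_total N k with hk | hk
  · refine (Real.exp_le_exp.2 ?_).trans (hbig k hk)
    nlinarith [(Nat.cast_nonneg N : (0:ℝ) ≤ N)]
  · refine (Real.exp_le_exp.2 ?_).trans ((hbig N le_rfl).trans ?_)
    · nlinarith [(Nat.cast_nonneg k : (0:ℝ) ≤ k)]
    · refine measureReal_mono (Metric.closedBall_subset_closedBall (Real.exp_le_exp.2 ?_))
        (measure_ne_top _ _)
      have : (k : ℝ) ≤ N := by exact_mod_cast hk
      nlinarith

lemma tendsto_div_of_abs_sub_le {u v : ℕ → ℝ} {C χ : ℝ}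
    (hu : Tendsto (fun n : ℕ => u n / n) atTop (nhds χ)) (h : ∀ n, |u n - v n| ≤ C) :
    Tendsto (fun n : ℕ => v n / n) atTop (nhds χ) := by
  have h0 : Tendsto (fun n : ℕ => (u n - v n) / n) atTop (nhds 0) := by
    refine squeeze_zero_norm (fun n => ?_) (tendsto_const_div_atTop_nhds_zero_nat C)
    rw [Real.norm_eq_abs, abs_div, Nat.abs_cast]
    gcongr
    exact h n
  have := hu.sub h0
  simp only [sub_zero] at this
  refine this.congr fun n => ?_
  ring

lemma measurable_measure_ballE (μ : Measure (ℝ × ℝ)) [IsFiniteMeasure μ] (r : ℝ) :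
    Measurable fun x => (μ (ballE x r)).toReal :=
  (measurable_measure_prodMk_left (measurableSet_setOf_dE_le r)).ennreal_toReal

lemma monotone_measure_ballE (μ : Measure (ℝ × ℝ)) [IsFiniteMeasure μ] (x : ℝ × ℝ) :
    Monotone fun r => (μ (ballE x r)).toReal := fun _ _ hr =>
  measureReal_mono (fun _ hy => le_trans (α := ℝ) hy hr) (measure_ne_top _ _)

/-- Lower bounds for the measures of balls along a geometric sequence of radii that hold almost
everywhere for a lift of the measure bound the upper local dimension almost everywhere. -/
lemma ae_limsup_le_of_ae_comp {X : Type*} [MeasurableSpace X] {m : Measure X}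
    [IsProbabilityMeasure m] {Pi : X → ℝ × ℝ} (hPi : Measurable Pi) {b : ℝ} (hb : 0 ≤ b)
    (h : ∀ δ > (0:ℝ), ∀ᵐ ii ∂m, ∀ᶠ r in nhdsWithin 0 (Set.Ioi 0),
      Real.exp ((b + δ) * Real.log r) ≤ ((m.map Pi) (ballE (Pi ii) r)).toReal) :
    ∀ᵐ x ∂(m.map Pi), limsup (fun r => Real.log ((m.map Pi) (ballE x r)).toReal / Real.log r)
      (nhdsWithin 0 (Set.Ioi 0)) ≤ b := by
  have : IsProbabilityMeasure (m.map Pi) := Measure.isProbabilityMeasure_map hPi.aemeasurable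
  have hae : ∀ᵐ x ∂(m.map Pi), ∀ j : ℕ, ∀ᶠ k : ℕ in atTop,
      Real.exp ((b + 1 / ((j : ℝ) + 1)) * -k) ≤
        ((m.map Pi) (ballE x (Real.exp (-(k : ℝ))))).toReal := by
    rw [ae_all_iff]
    intro j
    have hmeas : MeasurableSet {x | ∀ᶠ k : ℕ in atTop, Real.exp ((b + 1 / ((j : ℝ) + 1)) * -k) ≤
        ((m.map Pi) (ballE x (Real.exp (-(k : ℝ))))).toReal} := by
      simp only [eventually_atTop, ofPred_exists, ofPred_forall]
      exact MeasurableSet.iUnion fun N => MeasurableSet.iInter fun k => MeasurableSet.iInter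
        fun _ => measurableSet_le measurable_const (measurable_measure_ballE _ _)
    rw [ae_map_iff hPi.aemeasurable hmeas]
    filter_upwards [h (1 / ((j : ℝ) + 1)) (by positivity)] with ii hii
    have := (tendsto_exp_neg_nat_mul one_pos).eventually hii
    simpa only [Real.log_exp, mul_one] using this
  filter_upwards [hae] with x hx
  have hlim : Tendsto (fun j : ℕ => b + 2 * (1 / ((j : ℝ) + 1))) atTop (nhds b) := by
    simpa using (tendsto_one_div_add_atTop_nhds_zero_nat (𝕜 := ℝ)).const_mul 2 |>.const_add b
  refine ge_of_tendsto hlim (Eventually.of_forall fun j => ?_)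
  set e : ℝ := 1 / ((j : ℝ) + 1) with he
  have he0 : 0 < e := by positivity
  have hev := eventually_exp_mul_log_le (monotone_measure_ballE (m.map Pi) x)
    (β := fun k => -(k : ℝ)) (φ := fun k => (b + e) * -k) (χ := -1) (ψ := -(b + e))
    (V := {k : ℕ | Real.exp ((b + e) * -k) ≤
        ((m.map Pi) (ballE x (Real.exp (-(k : ℝ))))).toReal})
    (by norm_num) (by linarith)
    (tendsto_const_nhds.congr' (by
      filter_upwards [eventually_ne_atTop 0] with k hk
      have : (k : ℝ) ≠ 0 := by exact_mod_cast hk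
      field_simp))
    (tendsto_const_nhds.congr' (by
      filter_upwards [eventually_ne_atTop 0] with k hk
      have : (k : ℝ) ≠ 0 := by exact_mod_cast hk
      field_simp))
    (fun ε hε => by
      filter_upwards [hx j] with k hk
      exact ⟨k, le_rfl, by nlinarith [(Nat.cast_nonneg k : (0:ℝ) ≤ k)], hk⟩)
    (fun n hn => hn) he0
  refine limsup_le_of_le ?_ ?_
  · exact (isBoundedUnder_of_eventually_ge
      (eventually_log_measure_div_log_nonneg _ _)).isCoboundedUnder_le
  · filter_upwards [hev, Real.tendsto_log_nhdsGT_zero.eventually_lt_atBot 0] with r hr hlog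
    rw [div_le_iff_of_neg hlog]
    have h1 := (Real.le_log_iff_exp_le ((Real.exp_pos _).trans_le hr)).2 hr
    have h2 : -(b + e) / -1 + e = b + 2 * e := by ring
    rwa [h2] at h1

end LocalDimension

section Main

variable {I : Type} [Fintype I] [MeasurableSpace I] [MeasurableSingletonClass I] {T : System I}
  {Pi : (ℕ → I) → ℝ × ℝ} {m : Measure (ℕ → I)} [IsProbabilityMeasure m] {L h χ₁ χ₂ t : ℝ}

lemma ae_measure_cyl_word_pos {J : Type} [Countable J] [MeasurableSpace J]
    (m : Measure (ℕ → J)) [IsFiniteMeasure m] :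
    ∀ᵐ ii ∂m, ∀ n, 0 < (m (cyl (word ii n))).toReal := by
  have h : ∀ᵐ ii ∂m, ∀ w : List J, ii ∈ cyl w → m (cyl w) ≠ 0 := by
    rw [ae_all_iff]
    intro w
    by_cases hw : m (cyl w) = 0
    · filter_upwards [measure_eq_zero_iff_ae_notMem.1 hw] with ii hii hmem
      exact absurd hmem hii
    · exact Eventually.of_forall fun _ _ => hw
  filter_upwards [h] with ii hii n
  exact ENNReal.toReal_pos (hii _ (mem_cyl_word ii n)) (measure_ne_top _ _)

lemma ae_eventually_exp_le (hPi : IsCoding T Pi) (hPim : Measurable Pi)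
    (hQB : QuasiBernoulli m L) (herg : Ergodic (shift : (ℕ → I) → ℕ → I) m)
    (hh : h ≤ 0) (hχ21 : χ₂ ≤ χ₁) (hχ1 : χ₁ < 0)
    (hent : ∀ᵐ ii ∂m, Tendsto
      (fun n : ℕ => Real.log (m (cyl (word ii n))).toReal / n) atTop (nhds h))
    (hly1 : ∀ᵐ ii ∂m, Tendsto
      (fun n : ℕ => Real.log (alpha1 T (word ii n) (Pi (shiftn ii n))) / n) atTop (nhds χ₁))
    (hly2 : ∀ᵐ ii ∂m, Tendsto
      (fun n : ℕ => Real.log (alpha2 T (word ii n) (Pi (shiftn ii n))) / n) atTop (nhds χ₂))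
    (hproj : ExactDim1 ((m.map Pi).map Prod.fst) t) {s δ : ℝ} (hs : t < s) (hδ : 0 < δ) :
    ∀ᵐ ii ∂m, ∀ᶠ r in nhdsWithin 0 (Set.Ioi 0),
      Real.exp (((h + s * (χ₂ - χ₁)) / χ₂ + δ) * Real.log r) ≤
        ((m.map Pi) (ballE (Pi ii) r)).toReal := by
  have : IsProbabilityMeasure (m.map Pi) := Measure.isProbabilityMeasure_map hPim.aemeasurable
  have : IsProbabilityMeasure ((m.map Pi).map Prod.fst) :=
    Measure.isProbabilityMeasure_map measurable_fst.aemeasurable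
  set ν := (m.map Pi).map Prod.fst with hν
  have hs0 : 0 ≤ s := hproj.nonneg.trans hs.le
  have hlog2 : 0 < Real.log 2 := Real.log_pos (by norm_num)
  set K : ℕ → Set (ℕ → I) := fun N => {ii | ∀ k : ℕ, Real.exp (-((k + N) * (s * Real.log 2))) ≤
      (ν (Metric.closedBall (Pi ii).1 (Real.exp (-(k * Real.log 2))))).toReal} with hK
  have hKm : ∀ N, MeasurableSet (K N) := by
    intro N
    simp only [hK, ofPred_forall]
    refine MeasurableSet.iInter fun k => measurableSet_le measurable_const ?_
    have hball : MeasurableSet {p : ℝ × ℝ | dist p.2 p.1 ≤ Real.exp (-(k * Real.log 2))} :=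
      measurableSet_le (by fun_prop) measurable_const
    exact ((measurable_measure_prodMk_left (ν := ν) hball).comp
      (measurable_fst.comp hPim)).ennreal_toReal
  obtain ⟨N, hN⟩ : ∃ N, m (K N) ≠ 0 := by
    by_contra! hcon
    have h1 : ∀ᵐ ii ∂m, ∃ N, ii ∈ K N :=
      ae_of_ae_map hPim.aemeasurable (ae_of_ae_map measurable_fst.aemeasurable
        (hproj.ae_exists_exp_le hs))
    have h2 : ∀ᵐ ii ∂m, ∀ N, ii ∉ K N :=
      ae_all_iff.2 fun N => measure_eq_zero_iff_ae_notMem.1 (hcon N)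
    obtain ⟨ii, ⟨N, h3⟩, h4⟩ := (h1.and h2).exists
    exact h4 N h3
  obtain ⟨C, hC, hball⟩ := exists_ball_lower_bound hPi hPim m hQB
  obtain ⟨D, hD⟩ := exists_log_alpha_bound T
  obtain ⟨Q, -, hJ⟩ := exists_jacobian_bound T
  have hL := hQB.1
  filter_upwards [ae_exists_visit_of_ergodic herg (hKm N) hN, ae_measure_cyl_word_pos m, hent,
    hly1, hly2] with ii hvis hpos he h1 h2
  set u : ℕ → ℝ := fun n => Real.log (|fxw T (word ii n) (Pi (shiftn ii n))|)
  set v : ℕ → ℝ := fun n => Real.log (|gyw T (word ii n) (Pi (shiftn ii n))|)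
  set E : ℝ := Real.log L + (N + 1) * (s * Real.log 2)
  have hu : Tendsto (fun n : ℕ => u n / n) atTop (nhds χ₁) :=
    tendsto_div_of_abs_sub_le h1 fun n => (hD _ _ (hPi.mem_sq _)).1
  have hv : Tendsto (fun n : ℕ => v n / n) atTop (nhds χ₂) :=
    tendsto_div_of_abs_sub_le h2 fun n => (hD _ _ (hPi.mem_sq _)).2
  refine eventually_exp_mul_log_le (monotone_measure_ballE (m.map Pi) (Pi ii))
    (β := fun n => v n + Real.log C)
    (φ := fun n => Real.log (m (cyl (word ii n))).toReal + s * (v n - u n) - E)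
    (V := {n | shift^[n] ii ∈ K N}) (by linarith) ?_ ?_ ?_ hvis ?_ hδ
  · nlinarith
  · exact tendsto_div_of_abs_sub_le (C := |Real.log C|) hv fun n => by
      rw [sub_add_cancel_left, abs_neg]
  · have h3 := he.add ((hv.sub hu).const_mul s)
    refine tendsto_div_of_abs_sub_le (C := |E|)
      (u := fun n => Real.log (m (cyl (word ii n))).toReal + s * (v n - u n)) ?_ fun n => by
        rw [sub_sub_cancel]
    refine h3.congr fun n => ?_
    ring
  · intro n hn
    have hn' : shiftn ii n ∈ K N := by
      rw [← shift_iterate]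
      exact hn
    obtain ⟨hg0, hgf, -⟩ := hJ (word ii n) _ (hPi.mem_sq (shiftn ii n))
    have hf0 := hg0.trans_le hgf
    have hvu : v n ≤ u n := Real.log_le_log hg0 hgf
    set k : ℕ := ⌈(u n - v n) / Real.log 2⌉₊
    have hk1 : u n - v n ≤ k * Real.log 2 := (div_le_iff₀ hlog2).1 (Nat.le_ceil _)
    have hk2 : k * Real.log 2 ≤ u n - v n + Real.log 2 := by
      have := Nat.ceil_lt_add_one (div_nonneg (sub_nonneg.2 hvu) hlog2.le)
      rw [← sub_lt_iff_lt_add, lt_div_iff₀ hlog2] at this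
      linarith
    have key := hball ii n (Real.exp (-(k * Real.log 2))) (Real.exp_pos _) (by
      rw [← Real.exp_log hf0, ← Real.exp_log hg0, ← Real.exp_add]
      exact Real.exp_le_exp.2 (by linarith))
    have hexp : Real.exp (v n + Real.log C) =
        C * |gyw T (word ii n) (Pi (shiftn ii n))| := by
      rw [Real.exp_add, Real.exp_log hg0, Real.exp_log hC, mul_comm]
    rw [hexp]
    refine le_trans ?_ key
    have hcyl := hpos n
    calc Real.exp (Real.log (m (cyl (word ii n))).toReal + s * (v n - u n) - E)
        ≤ Real.exp (-Real.log L + Real.log (m (cyl (word ii n))).toReal +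
            -((k + N) * (s * Real.log 2))) := by
          refine Real.exp_le_exp.2 ?_
          have := mul_le_mul_of_nonneg_left hk2 hs0
          simp only [E]
          nlinarith
      _ = L⁻¹ * (m (cyl (word ii n))).toReal * Real.exp (-((k + N) * (s * Real.log 2))) := by
          rw [Real.exp_add, Real.exp_add, Real.exp_neg (Real.log L), Real.exp_log hL,
            Real.exp_log hcyl]
      _ ≤ _ := by
          gcongr
          exact hn' k

end Main

end FFL

/-- upper bound for the upper local dimension of `μ`. -/
theorem stmt19 {I : Type} [Fintype I] [MeasurableSpace I] (T : System I)
    (F : Set (ℝ × ℝ)) (hF : IsAttractor T F) (hSSC : SSC T F)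
    (Pi : (ℕ → I) → ℝ × ℝ) (hPi : IsCoding T Pi) (hPim : Measurable Pi)
    (m : Measure (ℕ → I)) [IsProbabilityMeasure m]
    (hshift : MeasurePreserving (shift : (ℕ → I) → ℕ → I) m m)
    (L : ℝ) (hQB : QuasiBernoulli m L)
    (herg : Ergodic (shift : (ℕ → I) → ℕ → I) m)
    (h χ₁ χ₂ t : ℝ) (hh : h ≤ 0) (hχ21 : χ₂ ≤ χ₁) (hχ1 : χ₁ < 0)
    (hent : ∀ᵐ ii ∂m, Tendsto
      (fun n : ℕ => Real.log (m (cyl (word ii n))).toReal / n) atTop (nhds h))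
    (hly1 : ∀ᵐ ii ∂m, Tendsto
      (fun n : ℕ => Real.log (alpha1 T (word ii n) (Pi (shiftn ii n))) / n) atTop (nhds χ₁))
    (hly2 : ∀ᵐ ii ∂m, Tendsto
      (fun n : ℕ => Real.log (alpha2 T (word ii n) (Pi (shiftn ii n))) / n) atTop (nhds χ₂))
    (hproj : ExactDim1 ((m.map Pi).map Prod.fst) t) :
    ∀ᵐ x ∂(m.map Pi),
      Filter.limsup (fun r => Real.log ((m.map Pi) (ballE x r)).toReal / Real.log r)
          (nhdsWithin 0 (Set.Ioi 0)) ≤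
        h / χ₂ + (χ₂ - χ₁) / χ₂ * t := by
  have := hPi.measurableSingletonClass hPim hF hSSC
  have : IsProbabilityMeasure (m.map Pi) := Measure.isProbabilityMeasure_map hPim.aemeasurable
  have : IsProbabilityMeasure ((m.map Pi).map Prod.fst) :=
    Measure.isProbabilityMeasure_map measurable_fst.aemeasurable
  have ht := hproj.nonneg
  have hχ2 : χ₂ < 0 := hχ21.trans_lt hχ1
  have hD : 0 ≤ (χ₂ - χ₁) / χ₂ := div_nonneg_of_nonpos (by linarith) hχ2.le
  refine ae_limsup_le_of_ae_comp hPim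
    (add_nonneg (div_nonneg_of_nonpos hh hχ2.le) (mul_nonneg hD ht)) fun δ hδ => ?_
  have hη : 0 < δ / ((χ₂ - χ₁) / χ₂ + 1) := by positivity
  set η := δ / ((χ₂ - χ₁) / χ₂ + 1) with hηdef
  have hrate : h / χ₂ + (χ₂ - χ₁) / χ₂ * t + δ = (h + (t + η) * (χ₂ - χ₁)) / χ₂ + η := by
    have hδη : δ = η * ((χ₂ - χ₁) / χ₂ + 1) := by rw [hηdef]; field_simp
    rw [hδη]
    ring
  rw [hrate]
  exact ae_eventually_exp_le hPi hPim hQB herg hh hχ21 hχ1 hent hly1 hly2 hproj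
    (lt_add_of_pos_right t hη) hη
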